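/- arXiv:quant-ph/0612186 — 2 statements merged into one kernel-verified Lean document; each statement's English description precedes it below -/
import Mathlib

section
/- Let G be a connected graph on n ≥ 3 vertices and |G⟩ the corresponding graph state with stabilizer S, and let δ(|G⟩) := min{wt(g) : g ∈ S, g ≠ I}. If d < δ(|G⟩) and H' is a nontrivial d-body Hamiltonian on n qubits, then |G⟩ is not a ground state of H'. Equivalently, any nontrivial n-qubit Hamiltonian having |G⟩ as a ground state must involve at least δ(|G⟩)-body interactions. -/
open Matrix BigOperators
open scoped Classical

noncomputable section

/-- The state space of `n` qubits, `(ℂ²)^{⊗n}`, realized as functions from bit strings to `ℂ`. -/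
abbrev QState (n : ℕ) : Type := (Fin n → Fin 2) → ℂ

/-- Operators on `n` qubits. -/
abbrev QOp (n : ℕ) : Type := Matrix (Fin n → Fin 2) (Fin n → Fin 2) ℂ

/-- The single qubit Pauli matrices: `0 ↦ σ₀ = I`, `1 ↦ σ_x`, `2 ↦ σ_y`, `3 ↦ σ_z`. -/
def pauli1 (k : Fin 4) : Matrix (Fin 2) (Fin 2) ℂ :=
  if k = 0 then 1
  else if k = 1 then !![0, 1; 1, 0]
  else if k = 2 then !![0, -Complex.I; Complex.I, 0]
  else !![1, 0; 0, -1]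

/-- The `n`-qubit Pauli operator `σ_{f 0} ⊗ σ_{f 1} ⊗ ⋯ ⊗ σ_{f (n-1)}`. -/
def pauliOp {n : ℕ} (f : Fin n → Fin 4) : QOp n :=
  Matrix.of fun v w => ∏ i, pauli1 (f i) (v i) (w i)

/-- The support of a Pauli operator: the qubits on which it acts nontrivially. -/
def pSupport {n : ℕ} (f : Fin n → Fin 4) : Finset (Fin n) :=
  Finset.univ.filter fun i => f i ≠ 0

/-- The weight of a Pauli operator: the number of qubits on which it acts nontrivially. -/
def pWeight {n : ℕ} (f : Fin n → Fin 4) : ℕ := (pSupport f).card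

/-- `g` is the signed Pauli operator `±σ_f`. -/
def IsSignedPauli {n : ℕ} (g : QOp n) (f : Fin n → Fin 4) : Prop :=
  g = pauliOp f ∨ g = -pauliOp f

/-- The squared norm `∑_v |ψ_v|²` of an `n`-qubit state. -/
def qNormSq {n : ℕ} (ψ : QState n) : ℝ := ∑ v, Complex.normSq (ψ v)

/-- The inner product `⟨φ|ψ⟩` (antilinear in the first argument). -/
def qInner {n : ℕ} (φ ψ : QState n) : ℂ := ∑ v, starRingEnd ℂ (φ v) * ψ v

/-- The graph state correlation operator `K_a = σ_x^(a) ∏_{b ∈ N(a)} σ_z^(b)`. -/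
def Kop {n : ℕ} (G : SimpleGraph (Fin n)) [DecidableRel G.Adj] (a : Fin n) : QOp n :=
  pauliOp fun b => if b = a then 1 else if G.Adj a b then 3 else 0

/-- `ψ` is the graph state `|G⟩`: a unit vector fixed by all correlation operators `K_a`. -/
def IsGraphState {n : ℕ} (G : SimpleGraph (Fin n)) [DecidableRel G.Adj] (ψ : QState n) : Prop :=
  qNormSq ψ = 1 ∧ ∀ a : Fin n, Kop G a *ᵥ ψ = ψ

/-- The stabilizer of `ψ`: all signed Pauli operators `g = ±σ` with `g ψ = ψ`. -/
def stab {n : ℕ} (ψ : QState n) : Set (QOp n) :=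
  {g | (∃ f, IsSignedPauli g f) ∧ g *ᵥ ψ = ψ}

/-- The stabilizer elements of weight at most `d`. -/
def stabW {n : ℕ} (ψ : QState n) (d : ℕ) : Set (QOp n) :=
  {g | g ∈ stab ψ ∧ ∃ f, IsSignedPauli g f ∧ pWeight f ≤ d}

/-- `S_d`: the subgroup of the stabilizer generated by all elements of weight at most `d`,
as a set of operators.  (Since the stabilizer is a finite group, the generated submonoid
coincides with the generated subgroup.) -/
def SdSet {n : ℕ} (ψ : QState n) (d : ℕ) : Set (QOp n) :=
  (Submonoid.closure (stabW ψ d) : Set (QOp n))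

/-- `δ(|ψ⟩)`: the minimal weight of a nonidentity element of the stabilizer of `ψ`. -/
def deltaG {n : ℕ} (ψ : QState n) : ℕ :=
  sInf {d | ∃ g ∈ stab ψ, g ≠ 1 ∧ ∃ f, IsSignedPauli g f ∧ pWeight f = d}

/-- `η(|ψ⟩)`: the minimal `d` such that `S_d = S`. -/
def etaG {n : ℕ} (ψ : QState n) : ℕ :=
  sInf {d | stab ψ ⊆ SdSet ψ d}

/-- A `d`-body Hamiltonian on `n` qubits: a real linear combination of Pauli operators
of weight at most `d`. -/
def IsDBody {n : ℕ} (d : ℕ) (H : QOp n) : Prop :=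
  ∃ h : (Fin n → Fin 4) → ℝ, (∀ f, d < pWeight f → h f = 0) ∧
    H = ∑ f : Fin n → Fin 4, (h f : ℂ) • pauliOp f

/-- A Hamiltonian is nontrivial if it is nonzero and not a multiple of the identity. -/
def NontrivialHam {n : ℕ} (H : QOp n) : Prop :=
  H ≠ 0 ∧ ∀ c : ℂ, H ≠ c • (1 : QOp n)

/-- `φ` is an eigenvector of `H` with (real) eigenvalue `E`. -/
def IsEigenpair {n : ℕ} (H : QOp n) (E : ℝ) (φ : QState n) : Prop :=
  φ ≠ 0 ∧ H *ᵥ φ = (E : ℂ) • φ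

/-- `ψ` is a ground state of `H` with ground energy `E`: an eigenvector for the smallest
eigenvalue `E` of `H`. -/
def IsGroundStateE {n : ℕ} (H : QOp n) (ψ : QState n) (E : ℝ) : Prop :=
  IsEigenpair H E ψ ∧ ∀ E' φ, IsEigenpair H E' φ → E ≤ E'

/-- `ψ` is a ground state of `H`. -/
def IsGroundState {n : ℕ} (H : QOp n) (ψ : QState n) : Prop :=
  ∃ E, IsGroundStateE H ψ E

/-- The dimension of the eigenspace of `H` for the eigenvalue `E` (the multiplicity of `E`). -/
def eigDim {n : ℕ} (H : QOp n) (E : ℝ) : ℕ :=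
  Module.finrank ℂ (Module.End.eigenspace (Matrix.mulVecLin H) ((E : ℂ)))


open scoped ComplexOrder

/-- The tensor product `A 0 ⊗ A 1 ⊗ ⋯ ⊗ A (n-1)` of single-qubit operators. -/
def tensorOp {n : ℕ} (A : Fin n → Matrix (Fin 2) (Fin 2) ℂ) : QOp n :=
  Matrix.of fun v w => ∏ i, A i (v i) (w i)

lemma pauliOp_eq_tensorOp {n : ℕ} (f : Fin n → Fin 4) :
    pauliOp f = tensorOp fun i => pauli1 (f i) := rfl

lemma tensorOp_mul {n : ℕ} (A B : Fin n → Matrix (Fin 2) (Fin 2) ℂ) :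
    tensorOp A * tensorOp B = tensorOp fun i => A i * B i := by
  ext v w
  simp only [tensorOp, Matrix.mul_apply, Matrix.of_apply, Finset.prod_univ_sum,
    Fintype.piFinset_univ, Finset.prod_mul_distrib]

lemma tensorOp_one {n : ℕ} : tensorOp (fun _ : Fin n => 1) = 1 := by
  ext v w
  simp only [tensorOp, Matrix.of_apply, Matrix.one_apply, Finset.prod_ite_zero,
    Finset.prod_const_one, Finset.mem_univ, true_imp_iff, funext_iff]

lemma tensorOp_smul {n : ℕ} (c : Fin n → ℂ) (A : Fin n → Matrix (Fin 2) (Fin 2) ℂ) :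
    tensorOp (fun i => c i • A i) = (∏ i, c i) • tensorOp A := by
  ext v w
  simp [tensorOp, Finset.prod_mul_distrib]

lemma trace_tensorOp {n : ℕ} (A : Fin n → Matrix (Fin 2) (Fin 2) ℂ) :
    (tensorOp A).trace = ∏ i, (A i).trace := by
  simp only [tensorOp, Matrix.trace, Matrix.diag_apply, Matrix.of_apply, Finset.prod_univ_sum,
    Fintype.piFinset_univ]

lemma conjTranspose_tensorOp {n : ℕ} (A : Fin n → Matrix (Fin 2) (Fin 2) ℂ) :
    (tensorOp A)ᴴ = tensorOp fun i => (A i)ᴴ := by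
  ext v w
  simp [tensorOp, Matrix.conjTranspose_apply]

lemma pauli1_zero : pauli1 0 = 1 := rfl

lemma pauli1_isHermitian (k : Fin 4) : (pauli1 k)ᴴ = pauli1 k := by
  fin_cases k <;> ext i j <;> fin_cases i <;> fin_cases j <;> simp [pauli1]

lemma pauli1_mul_self (k : Fin 4) : pauli1 k * pauli1 k = 1 := by
  fin_cases k <;> ext i j <;> fin_cases i <;> fin_cases j <;> simp [pauli1, Matrix.mul_apply]

lemma trace_pauli1 {k : Fin 4} (hk : k ≠ 0) : (pauli1 k).trace = 0 := by
  fin_cases k <;> simp_all [pauli1, Matrix.trace]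

lemma pauli1_comm_or_anticomm (k l : Fin 4) :
    ∃ c : ℂ, (c = 1 ∨ c = -1) ∧ pauli1 k * pauli1 l = c • (pauli1 l * pauli1 k) := by
  have h : pauli1 k * pauli1 l = pauli1 l * pauli1 k ∨
      pauli1 k * pauli1 l = -(pauli1 l * pauli1 k) := by
    fin_cases k <;> fin_cases l <;> simp [pauli1]
  rcases h with h | h
  · exact ⟨1, Or.inl rfl, by simpa using h⟩
  · exact ⟨-1, Or.inr rfl, by simpa using h⟩

lemma pauliOp_zero {n : ℕ} : pauliOp (0 : Fin n → Fin 4) = 1 := by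
  simp only [pauliOp_eq_tensorOp, Pi.zero_apply, pauli1_zero, tensorOp_one]

lemma pauliOp_isHermitian {n : ℕ} (f : Fin n → Fin 4) : (pauliOp f).IsHermitian := by
  simp only [Matrix.IsHermitian, pauliOp_eq_tensorOp, conjTranspose_tensorOp, pauli1_isHermitian]

lemma pauliOp_mul_self {n : ℕ} (f : Fin n → Fin 4) : pauliOp f * pauliOp f = 1 := by
  simp only [pauliOp_eq_tensorOp, tensorOp_mul, pauli1_mul_self, tensorOp_one]

lemma trace_pauliOp {n : ℕ} {f : Fin n → Fin 4} (hf : f ≠ 0) : (pauliOp f).trace = 0 := by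
  obtain ⟨i, hi⟩ := Function.ne_iff.mp hf
  rw [pauliOp_eq_tensorOp, trace_tensorOp]
  exact Finset.prod_eq_zero (Finset.mem_univ i) (trace_pauli1 hi)

lemma pauliOp_comm_or_anticomm {n : ℕ} (f g : Fin n → Fin 4) :
    pauliOp f * pauliOp g = pauliOp g * pauliOp f ∨
      pauliOp f * pauliOp g = -(pauliOp g * pauliOp f) := by
  choose c hc h using fun i => pauli1_comm_or_anticomm (f i) (g i)
  have key : pauliOp f * pauliOp g = (∏ i, c i) • (pauliOp g * pauliOp f) := by
    simp only [pauliOp_eq_tensorOp, tensorOp_mul, h, tensorOp_smul]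
  have hsign : (∏ i, c i) = 1 ∨ (∏ i, c i) = -1 :=
    Finset.prod_induction c (fun x => x = 1 ∨ x = -1)
      (by rintro a b (rfl | rfl) (rfl | rfl) <;> simp) (Or.inl rfl) fun i _ => hc i
  rcases hsign with hs | hs <;> simp [key, hs]

lemma trace_one_ne_zero {n : ℕ} : (1 : QOp n).trace ≠ 0 := by
  simp [Matrix.trace_one]

lemma signedPauli_ne_one {n : ℕ} {f : Fin n → Fin 4} (hf : f ≠ 0) {g : QOp n}
    (hg : IsSignedPauli g f) : g ≠ 1 := by
  rintro rfl
  apply trace_one_ne_zero (n := n)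
  rcases hg with hg | hg <;> simp [hg, Matrix.trace_neg, trace_pauliOp hf]

lemma Kop_apply_ne_zero {n : ℕ} (G : SimpleGraph (Fin n)) [DecidableRel G.Adj] (a : Fin n)
    {v w : Fin n → Fin 2} (h : Kop G a v w ≠ 0) : w = Function.update v a (1 - v a) := by
  have h' : ∀ i, pauli1 (if i = a then 1 else if G.Adj a i then 3 else 0) (v i) (w i) ≠ 0 :=
    fun i hi => h (Finset.prod_eq_zero (Finset.mem_univ i) hi)
  funext i
  have hi := h' i
  by_cases hia : i = a
  · subst hia
    revert hi
    generalize v i = x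
    generalize w i = y
    fin_cases x <;> fin_cases y <;> simp [pauli1]
  · rw [Function.update_of_ne hia]
    revert hi
    generalize v i = x
    generalize w i = y
    by_cases hadj : G.Adj a i <;> fin_cases x <;> fin_cases y <;> simp [pauli1, hia, hadj]

/-- A vector fixed by all correlation operators and vanishing on one bit string vanishes. -/
lemma eq_zero_of_fixed_of_apply_eq_zero {n : ℕ} (G : SimpleGraph (Fin n)) [DecidableRel G.Adj]
    {χ : QState n} (hχ : ∀ a, Kop G a *ᵥ χ = χ) {u : Fin n → Fin 2} (hu : χ u = 0) : χ = 0 := by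
  have flip : ∀ (a : Fin n) (v : Fin n → Fin 2),
      χ (Function.update v a (1 - v a)) = 0 → χ v = 0 := by
    intro a v hv
    rw [← hχ a, Matrix.mulVec, dotProduct]
    refine Finset.sum_eq_zero fun w _ => ?_
    by_cases hw : Kop G a v w = 0
    · rw [hw, zero_mul]
    · rw [Kop_apply_ne_zero G a hw, hv, mul_zero]
  have agree : ∀ (s : Finset (Fin n)) (v : Fin n → Fin 2), (∀ i ∉ s, v i = u i) → χ v = 0 := by
    intro s
    induction s using Finset.induction_on with
    | empty =>
      intro v hv
      rwa [show v = u from funext fun i => hv i (Finset.notMem_empty i)]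
    | insert a s has ih =>
      intro v hv
      by_cases hva : v a = u a
      · refine ih v fun i hi => ?_
        by_cases hia : i = a
        · rw [hia, hva]
        · exact hv i (by simp [hia, hi])
      · refine flip a v (ih _ fun i hi => ?_)
        by_cases hia : i = a
        · subst hia
          rw [Function.update_self]
          revert hva
          generalize v i = x
          generalize u i = y
          fin_cases x <;> fin_cases y <;> simp
        · rw [Function.update_of_ne hia]
          exact hv i (by simp [hia, hi])
  funext v
  exact agree Finset.univ v fun i hi => absurd (Finset.mem_univ i) hi

lemma IsGraphState.ne_zero {n : ℕ} {G : SimpleGraph (Fin n)} [DecidableRel G.Adj]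
    {ψ : QState n} (hψ : IsGraphState G ψ) : ψ ≠ 0 := by
  rintro rfl
  simpa [qNormSq] using hψ.1

lemma IsGraphState.eq_smul_of_fixed {n : ℕ} {G : SimpleGraph (Fin n)} [DecidableRel G.Adj]
    {ψ φ : QState n} (hψ : IsGraphState G ψ) (hφ : ∀ a, Kop G a *ᵥ φ = φ) :
    ∃ c : ℂ, φ = c • ψ := by
  obtain ⟨u, hu⟩ := Function.ne_iff.mp hψ.ne_zero
  rw [Pi.zero_apply] at hu
  refine ⟨φ u / ψ u, sub_eq_zero.mp
    (eq_zero_of_fixed_of_apply_eq_zero G (fun a => ?_) (u := u) ?_)⟩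
  · rw [Matrix.mulVec_sub, Matrix.mulVec_smul, hφ, hψ.2]
  · simp [hu]

/-- Pauli operators of nonzero weight below `δ` have vanishing expectation in the graph state. -/
lemma IsGraphState.expectation_eq_zero {n : ℕ} {G : SimpleGraph (Fin n)} [DecidableRel G.Adj]
    {ψ : QState n} (hψ : IsGraphState G ψ) {f : Fin n → Fin 4} (hf : f ≠ 0)
    (hwt : pWeight f < deltaG ψ) : star ψ ⬝ᵥ (pauliOp f *ᵥ ψ) = 0 := by
  by_cases hcomm : ∀ a, pauliOp f * Kop G a = Kop G a * pauliOp f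
  · exfalso
    obtain ⟨c, hc⟩ := hψ.eq_smul_of_fixed (φ := pauliOp f *ᵥ ψ) fun a => by
      rw [Matrix.mulVec_mulVec, ← hcomm a, ← Matrix.mulVec_mulVec, hψ.2 a]
    have hcc : (c * c - 1) • ψ = 0 := by
      rw [sub_smul, one_smul, mul_smul, ← hc, ← Matrix.mulVec_smul, ← hc, Matrix.mulVec_mulVec,
        pauliOp_mul_self, Matrix.one_mulVec, sub_self]
    have hc1 : c = 1 ∨ c = -1 :=
      mul_self_eq_one_iff.mp (sub_eq_zero.mp ((smul_eq_zero.mp hcc).resolve_right hψ.ne_zero))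
    obtain ⟨g, hg, hgψ⟩ : ∃ g, IsSignedPauli g f ∧ g *ᵥ ψ = ψ := by
      rcases hc1 with rfl | rfl
      · exact ⟨pauliOp f, Or.inl rfl, by simpa using hc⟩
      · exact ⟨-pauliOp f, Or.inr rfl, by simp [Matrix.neg_mulVec, hc]⟩
    exact hwt.not_ge (Nat.sInf_le ⟨g, ⟨⟨f, hg⟩, hgψ⟩, signedPauli_ne_one hf hg, f, hg, rfl⟩)
  · obtain ⟨a, ha⟩ := not_forall.mp hcomm
    have hanti : pauliOp f * Kop G a = -(Kop G a * pauliOp f) :=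
      (pauliOp_comm_or_anticomm f _).resolve_left ha
    have hleft : star ψ ᵥ* Kop G a = star ψ := by
      have hK : (Kop G a)ᴴ = Kop G a := pauliOp_isHermitian _
      rw [← hK, ← Matrix.star_mulVec, hψ.2 a]
    have hneg : star ψ ⬝ᵥ (pauliOp f *ᵥ ψ) = -(star ψ ⬝ᵥ (pauliOp f *ᵥ ψ)) := by
      conv_lhs => rw [← hψ.2 a, Matrix.mulVec_mulVec, hψ.2 a, hanti, Matrix.neg_mulVec,
        dotProduct_neg, ← Matrix.mulVec_mulVec, Matrix.dotProduct_mulVec, hleft]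
    exact self_eq_neg.mp hneg

lemma IsDBody.isHermitian {n d : ℕ} {H : QOp n} (hH : IsDBody d H) : H.IsHermitian := by
  obtain ⟨h, -, rfl⟩ := hH
  simp only [Matrix.IsHermitian, Matrix.conjTranspose_sum, Matrix.conjTranspose_smul,
    (pauliOp_isHermitian _).eq, RCLike.star_def, Complex.conj_ofReal]

lemma sub_groundEnergy_posSemidef {n : ℕ} {H : QOp n} (hH : H.IsHermitian) {ψ : QState n} {E : ℝ}
    (hE : IsGroundStateE H ψ E) : (H - (E : ℂ) • (1 : QOp n)).PosSemidef := by
  have hHE : (H - (E : ℂ) • (1 : QOp n)).IsHermitian := by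
    simp [Matrix.IsHermitian, hH.eq]
  rw [hHE.posSemidef_iff_eigenvalues_nonneg]
  intro i
  have hv := hHE.mulVec_eigenvectorBasis i
  have hpair : IsEigenpair H (hHE.eigenvalues i + E) (hHE.eigenvectorBasis i).ofLp := by
    constructor
    · simpa using hHE.eigenvectorBasis.toBasis.ne_zero i
    · rw [Matrix.sub_mulVec, Matrix.smul_mulVec, Matrix.one_mulVec, sub_eq_iff_eq_add] at hv
      rw [hv, Complex.ofReal_add, add_smul]
      rfl
  simpa using hE.2 _ _ hpair

/-- for a connected graph `G` on `n ≥ 3` vertices with graph state `|G⟩`,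
if `d < δ(|G⟩)` and `H'` is a nontrivial `d`-body Hamiltonian on `n` qubits, then `|G⟩`
is not a ground state of `H'`; i.e. any nontrivial Hamiltonian having `|G⟩` as a ground
state must involve at least `δ(|G⟩)`-body interactions. -/
theorem no_ground_state_below_delta
    {n : ℕ} (hn : 3 ≤ n) (G : SimpleGraph (Fin n)) [DecidableRel G.Adj]
    (hG : G.Connected) (ψ : QState n) (hψ : IsGraphState G ψ)
    (d : ℕ) (hd : d < deltaG ψ) (H' : QOp n) (hH' : IsDBody d H')
    (hnt : NontrivialHam H') :
    ¬ IsGroundState H' ψ := by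
  rintro ⟨E, hE⟩
  have hHerm := hH'.isHermitian
  obtain ⟨h, hh, hsum⟩ := hH'
  have hterm : ∀ f ≠ 0, h f ≠ 0 → star ψ ⬝ᵥ (pauliOp f *ᵥ ψ) = 0 := fun f hf hhf =>
    hψ.expectation_eq_zero hf ((not_lt.mp fun hlt => hhf (hh f hlt)).trans_lt hd)
  have hexp : star ψ ⬝ᵥ (H' *ᵥ ψ) = (h 0 : ℂ) * (star ψ ⬝ᵥ ψ) := by
    rw [hsum, Matrix.sum_mulVec, dotProduct_sum, Finset.sum_eq_single 0]
    · rw [Matrix.smul_mulVec, dotProduct_smul, pauliOp_zero, Matrix.one_mulVec, smul_eq_mul]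
    · intro f _ hf
      rw [Matrix.smul_mulVec, dotProduct_smul, smul_eq_mul]
      by_cases hhf : h f = 0
      · simp [hhf]
      · rw [hterm f hf hhf, mul_zero]
    · exact fun h0 => absurd (Finset.mem_univ _) h0
  have hEh : (E : ℂ) = h 0 := by
    rw [hE.1.2, dotProduct_smul, smul_eq_mul] at hexp
    exact mul_right_cancel₀ (mt dotProduct_star_self_eq_zero.mp hψ.ne_zero) hexp
  have htrace : (H' - (E : ℂ) • (1 : QOp n)).trace = 0 := by
    rw [Matrix.trace_sub, hsum, Matrix.trace_sum, Finset.sum_eq_single 0, pauliOp_zero, hEh,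
      sub_self]
    · intro f _ hf
      rw [Matrix.trace_smul, trace_pauliOp hf, smul_zero]
    · exact fun h0 => absurd (Finset.mem_univ _) h0
  exact hnt.2 E (sub_eq_zero.mp
    ((sub_groundEnergy_posSemidef hHerm hE).trace_eq_zero_iff.mp htrace))
end
end

section
/- Let G = (V,E) be a graph on n vertices with adjacency matrix Γ over GF(2), |G⟩ the corresponding graph state with stabilizer S, and A ⊆ V. Then the number of elements g = ±σ_{i_1} ⊗ … ⊗ σ_{i_n} in S satisfying i_α = 0 for every α ∈ V∖A (i.e., acting trivially outside A) is exactly 2^{|A| − rank₂ Γ⟨A⟩}, where Γ⟨A⟩ := (Γ_{ab})_{a∈A, b∈V∖A} and rank₂ denotes matrix rank over GF(2). -/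
open Matrix BigOperators
open scoped Classical

noncomputable section

/-- The adjacency matrix of `G` over GF(2). -/
def adjMat2 {n : ℕ} (G : SimpleGraph (Fin n)) [DecidableRel G.Adj] :
    Matrix (Fin n) (Fin n) (ZMod 2) :=
  Matrix.of fun a b => if G.Adj a b then 1 else 0

/-- The off-diagonal block `Γ⟨A⟩ = (Γ_{ab})_{a ∈ A, b ∈ V∖A}` of the adjacency matrix. -/
def adjCut {n : ℕ} (G : SimpleGraph (Fin n)) [DecidableRel G.Adj] (A : Finset (Fin n)) :
    Matrix {a : Fin n // a ∈ A} {b : Fin n // b ∉ A} (ZMod 2) :=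
  Matrix.of fun a b => adjMat2 G a.val b.val

/-- The nontrivial additive character of `ZMod 2`, `t ↦ (-1)^t`. -/
def signChar : AddChar (ZMod 2) ℂ where
  toFun t := if t = 0 then 1 else -1
  map_zero_eq_one' := by simp
  map_add_eq_mul' a b := by
    obtain rfl | rfl : a = 0 ∨ a = 1 := by revert a; decide
    · simp
    · obtain rfl | rfl : b = 0 ∨ b = 1 := by revert b; decide
      · simp
      · simp [show (1 : ZMod 2) + 1 = 0 by decide]

lemma signChar_apply (t : ZMod 2) : signChar t = if t = 0 then 1 else -1 := rfl

lemma signChar_eq_one_iff (t : ZMod 2) : signChar t = 1 ↔ t = 0 := by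
  rw [signChar_apply]
  split_ifs with h
  · simp [h]
  · simp only [h, iff_false]
    norm_num

lemma signChar_mul_self (t : ZMod 2) : signChar t * signChar t = 1 := by
  rw [← AddChar.map_add_eq_mul, CharTwo.add_self_eq_zero, AddChar.map_zero_eq_one]

/-- The bit recording whether a single qubit Pauli matrix flips the computational basis. -/
def xBit (k : Fin 4) : ZMod 2 := ![0, 1, 1, 0] k

/-- The bit recording whether a single qubit Pauli matrix contains a factor `σ_z`. -/
def zBit (k : Fin 4) : ZMod 2 := ![0, 0, 1, 1] k

/-- The scalar relating a Pauli matrix to the product of its `σ_z` and `σ_x` parts. -/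
def pauliPhase (k : Fin 4) : ℂ := ![1, 1, -Complex.I, 1] k

/-- The Pauli index with prescribed `x` and `z` bits. -/
def pauliOfBits (x z : ZMod 2) : Fin 4 :=
  if x = 0 then (if z = 0 then 0 else 3) else (if z = 0 then 1 else 2)

lemma xBit_pauliOfBits (x z : ZMod 2) : xBit (pauliOfBits x z) = x := by
  fin_cases x <;> fin_cases z <;> rfl

lemma zBit_pauliOfBits (x z : ZMod 2) : zBit (pauliOfBits x z) = z := by
  fin_cases x <;> fin_cases z <;> rfl

lemma pauliOfBits_xBit_zBit (k : Fin 4) : pauliOfBits (xBit k) (zBit k) = k := by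
  fin_cases k <;> rfl

lemma pauliPhase_ne_zero (k : Fin 4) : pauliPhase k ≠ 0 := by
  fin_cases k <;> simp [pauliPhase]

lemma pauliPhase_sq (k : Fin 4) :
    pauliPhase k * pauliPhase k * signChar (zBit k * xBit k) = 1 := by
  fin_cases k <;> simp [pauliPhase, signChar_apply, zBit, xBit]

/-- The entry of a single qubit Pauli matrix at bits in `ZMod 2`. -/
def pauliEntry (k : Fin 4) (a b : ZMod 2) : ℂ := pauli1 k a b

lemma pauliEntry_eq (k : Fin 4) (a b : ZMod 2) :
    pauliEntry k a b =
      if b = a + xBit k then pauliPhase k * signChar (zBit k * a) else 0 := by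
  have h : (1 : ZMod 2) + 1 = 0 := by decide
  have h00 : pauliEntry k 0 0 = pauli1 k 0 0 := rfl
  have h01 : pauliEntry k 0 1 = pauli1 k 0 1 := rfl
  have h10 : pauliEntry k 1 0 = pauli1 k 1 0 := rfl
  have h11 : pauliEntry k 1 1 = pauli1 k 1 1 := rfl
  obtain rfl | rfl : a = 0 ∨ a = 1 := by revert a; decide
  all_goals obtain rfl | rfl : b = 0 ∨ b = 1 := by revert b; decide
  · rw [h00]; fin_cases k <;> simp [pauli1, pauliPhase, xBit]
  · rw [h01]; fin_cases k <;> simp [pauli1, pauliPhase, xBit]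
  · rw [h10]; fin_cases k <;> simp [pauli1, pauliPhase, signChar_apply, zBit, xBit, h]
  · rw [h11]; fin_cases k <;> simp [pauli1, pauliPhase, signChar_apply, zBit, xBit, h]

variable {n : ℕ}

/-- The amplitude of a state at a bit string over `ZMod 2`. -/
def amp (ψ : QState n) (v : Fin n → ZMod 2) : ℂ := ψ v

/-- The entry of an operator at bit strings over `ZMod 2`. -/
def opEntry (g : QOp n) (v w : Fin n → ZMod 2) : ℂ := g v w

lemma amp_ext {φ ψ : QState n} (h : ∀ v, amp φ v = amp ψ v) : φ = ψ := funext h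

lemma amp_neg (ψ : QState n) (v : Fin n → ZMod 2) : amp (-ψ) v = -amp ψ v := rfl

lemma amp_smul (c : ℂ) (ψ : QState n) (v : Fin n → ZMod 2) : amp (c • ψ) v = c * amp ψ v := rfl

lemma opEntry_neg (g : QOp n) (v w : Fin n → ZMod 2) : opEntry (-g) v w = -opEntry g v w := rfl

lemma amp_mulVec (g : QOp n) (ψ : QState n) (v : Fin n → ZMod 2) :
    amp (g *ᵥ ψ) v = ∑ w, opEntry g v w * amp ψ w := rfl

lemma add_self_eq_zero_of_bits (x : Fin n → ZMod 2) : x + x = 0 :=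
  funext fun _ => CharTwo.add_self_eq_zero _

lemma signChar_sum {ι : Type*} (s : Finset ι) (t : ι → ZMod 2) :
    signChar (∑ i ∈ s, t i) = ∏ i ∈ s, signChar (t i) := by
  induction s using Finset.induction_on with
  | empty => simp
  | insert a s ha ih => rw [Finset.sum_insert ha, Finset.prod_insert ha,
      AddChar.map_add_eq_mul, ih]

lemma opEntry_pauliOp (f : Fin n → Fin 4) (v w : Fin n → ZMod 2) :
    opEntry (pauliOp f) v w = if w = v + xBit ∘ f then
      (∏ i, pauliPhase (f i)) * signChar ((zBit ∘ f) ⬝ᵥ v) else 0 := by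
  have h : opEntry (pauliOp f) v w = ∏ i, pauliEntry (f i) (v i) (w i) := rfl
  simp only [h, pauliEntry_eq]
  split_ifs with h
  · subst h
    simp [dotProduct, signChar_sum, Finset.prod_mul_distrib]
  · obtain ⟨i, hi⟩ := Function.ne_iff.mp h
    exact Finset.prod_eq_zero (Finset.mem_univ i) (if_neg hi)

lemma amp_pauliOp_mulVec (f : Fin n → Fin 4) (ψ : QState n) (v : Fin n → ZMod 2) :
    amp (pauliOp f *ᵥ ψ) v =
      (∏ i, pauliPhase (f i)) * signChar ((zBit ∘ f) ⬝ᵥ v) * amp ψ (v + xBit ∘ f) := by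
  rw [amp_mulVec, Finset.sum_eq_single (v + xBit ∘ f), opEntry_pauliOp, if_pos rfl]
  · intro w _ hw
    rw [opEntry_pauliOp, if_neg hw, zero_mul]
  · exact fun h => absurd (Finset.mem_univ _) h

lemma pauliOp_mulVec_mulVec (f : Fin n → Fin 4) (ψ : QState n) :
    pauliOp f *ᵥ (pauliOp f *ᵥ ψ) = ψ := by
  refine amp_ext fun v => ?_
  have hP : (∏ i, pauliPhase (f i)) * (∏ i, pauliPhase (f i)) *
      signChar ((zBit ∘ f) ⬝ᵥ (xBit ∘ f)) = 1 := by
    simp only [dotProduct, signChar_sum, ← Finset.prod_mul_distrib, Function.comp]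
    exact Finset.prod_eq_one fun i _ => pauliPhase_sq (f i)
  rw [amp_pauliOp_mulVec, amp_pauliOp_mulVec, add_assoc, add_self_eq_zero_of_bits, add_zero,
    dotProduct_add, AddChar.map_add_eq_mul]
  linear_combination amp ψ v * (∏ i, pauliPhase (f i)) * (∏ i, pauliPhase (f i)) *
    signChar ((zBit ∘ f) ⬝ᵥ (xBit ∘ f)) * signChar_mul_self ((zBit ∘ f) ⬝ᵥ v) + amp ψ v * hP

lemma xBit_comp_eq_of_isSignedPauli {g : QOp n} {f f' : Fin n → Fin 4}
    (h : IsSignedPauli g f) (h' : IsSignedPauli g f') : xBit ∘ f = xBit ∘ f' := by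
  have key : ∀ {k : Fin n → Fin 4}, IsSignedPauli g k →
      ∀ w : Fin n → ZMod 2, opEntry g 0 w ≠ 0 ↔ w = xBit ∘ k := by
    intro k hk w
    have hP : (∏ i, pauliPhase (k i)) ≠ 0 :=
      Finset.prod_ne_zero_iff.mpr fun i _ => pauliPhase_ne_zero _
    have hw : opEntry (pauliOp k) 0 w ≠ 0 ↔ w = xBit ∘ k := by
      rw [opEntry_pauliOp, zero_add, dotProduct_zero, AddChar.map_zero_eq_one, mul_one]
      simp [hP]
    rcases hk with rfl | rfl
    · exact hw
    · rwa [opEntry_neg, neg_ne_zero]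
  exact (key h' _).mp ((key h _).mpr rfl)

section GraphState

variable {G : SimpleGraph (Fin n)} [DecidableRel G.Adj] {ψ : QState n}

lemma transpose_adjMat2 (G : SimpleGraph (Fin n)) [DecidableRel G.Adj] :
    (adjMat2 G)ᵀ = adjMat2 G := by
  ext a b
  simp [adjMat2, G.adj_comm]

lemma IsGraphState.apply_add_single (hψ : IsGraphState G ψ) (a : Fin n) (v : Fin n → ZMod 2) :
    amp ψ (v + Pi.single a 1) = signChar ((adjMat2 G *ᵥ v) a) * amp ψ v := by
  have h : amp (Kop G a *ᵥ ψ) v = amp ψ v := by rw [hψ.2 a]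
  have hK := amp_pauliOp_mulVec (fun b => if b = a then 1 else if G.Adj a b then 3 else 0) ψ v
  have hx : (xBit ∘ fun b => if b = a then 1 else if G.Adj a b then 3 else 0) =
      Pi.single a 1 := by
    funext b
    by_cases hb : b = a
    · subst hb
      simp [xBit]
    · by_cases hab : G.Adj a b <;> simp [xBit, hb, hab]
  have hz : (zBit ∘ fun b => if b = a then 1 else if G.Adj a b then 3 else 0) =
      adjMat2 G a := by
    funext b
    by_cases hb : b = a
    · subst hb
      simp [zBit, adjMat2]
    · by_cases hab : G.Adj a b <;> simp [zBit, adjMat2, hb, hab]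
  have hp : (∏ b, pauliPhase (if b = a then 1 else if G.Adj a b then 3 else 0)) = 1 := by
    refine Finset.prod_eq_one fun b _ => ?_
    split_ifs <;> simp [pauliPhase]
  rw [hx, hz, hp, one_mul] at hK
  have h2 : signChar (adjMat2 G a ⬝ᵥ v) * amp ψ (v + Pi.single a 1) = amp ψ v := hK.symm.trans h
  change _ = signChar (adjMat2 G a ⬝ᵥ v) * amp ψ v
  linear_combination signChar (adjMat2 G a ⬝ᵥ v) * h2 -
    amp ψ (v + Pi.single a 1) * signChar_mul_self (adjMat2 G a ⬝ᵥ v)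

lemma IsGraphState.exists_apply_add (hψ : IsGraphState G ψ) (x : Fin n → ZMod 2) :
    ∃ s : ℂ, ∀ v : Fin n → ZMod 2,
      amp ψ (v + x) = s * signChar ((adjMat2 G *ᵥ x) ⬝ᵥ v) * amp ψ v := by
  have hx : x = ∑ i, Pi.single i (x i) := (Finset.univ_sum_single x).symm
  rw [hx]
  refine Finset.sum_induction _ (fun x : Fin n → ZMod 2 => ∃ s : ℂ, ∀ v : Fin n → ZMod 2,
      amp ψ (v + x) = s * signChar ((adjMat2 G *ᵥ x) ⬝ᵥ v) * amp ψ v) ?_ ?_ ?_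
  · rintro x y ⟨s, hs⟩ ⟨t, ht⟩
    refine ⟨s * t * signChar ((adjMat2 G *ᵥ y) ⬝ᵥ x), fun v => ?_⟩
    rw [← add_assoc, ht, hs, dotProduct_add, Matrix.mulVec_add, add_dotProduct,
      AddChar.map_add_eq_mul, AddChar.map_add_eq_mul]
    ring
  · exact ⟨1, fun v => by simp⟩
  · intro i _
    obtain h | h : x i = 0 ∨ x i = 1 := by
      generalize x i = t
      revert t
      decide
    · exact ⟨1, fun v => by simp [h]⟩
    · refine ⟨1, fun v => ?_⟩
      rw [h, hψ.apply_add_single, one_mul]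
      congr 2
      rw [Matrix.mulVec_single_one]
      change adjMat2 G i ⬝ᵥ v = (adjMat2 G)ᵀ i ⬝ᵥ v
      rw [transpose_adjMat2]

lemma IsGraphState.ne_zero_s3 (hψ : IsGraphState G ψ) : ψ ≠ 0 := by
  rintro rfl
  simpa [qNormSq] using hψ.1

lemma IsGraphState.apply_ne_zero (hψ : IsGraphState G ψ) (v : Fin n → ZMod 2) : amp ψ v ≠ 0 := by
  intro hv
  refine hψ.ne_zero_s3 (amp_ext fun w => ?_)
  obtain ⟨s, hs⟩ := hψ.exists_apply_add (w - v)
  have h := hs v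
  rwa [hv, mul_zero, add_sub_cancel] at h

/-- A Pauli operator that stabilizes a graph state up to sign has `z` part `Γ x`. -/
lemma IsGraphState.zBit_eq (hψ : IsGraphState G ψ) {g : QOp n} {f : Fin n → Fin 4}
    (hg : IsSignedPauli g f) (h : g *ᵥ ψ = ψ) :
    zBit ∘ f = adjMat2 G *ᵥ (xBit ∘ f) := by
  obtain ⟨c, hc⟩ : ∃ c : ℂ, ∀ v : Fin n → ZMod 2,
      c * signChar ((zBit ∘ f) ⬝ᵥ v) * amp ψ (v + xBit ∘ f) = amp ψ v := by
    rcases hg with rfl | rfl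
    · exact ⟨_, fun v => by rw [← amp_pauliOp_mulVec, h]⟩
    · refine ⟨-∏ i, pauliPhase (f i), fun v => ?_⟩
      rw [neg_mul, neg_mul, ← amp_pauliOp_mulVec, ← amp_neg, ← Matrix.neg_mulVec, h]
  obtain ⟨s, hs⟩ := hψ.exists_apply_add (xBit ∘ f)
  have key : ∀ v : Fin n → ZMod 2,
      c * s * signChar ((zBit ∘ f + adjMat2 G *ᵥ (xBit ∘ f)) ⬝ᵥ v) = 1 := by
    intro v
    refine mul_right_cancel₀ (hψ.apply_ne_zero v) ?_
    have hv := hc v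
    rw [hs] at hv
    rw [add_dotProduct, AddChar.map_add_eq_mul]
    linear_combination hv
  have h0 := key 0
  rw [dotProduct_zero, AddChar.map_zero_eq_one, mul_one] at h0
  funext a
  rw [← CharTwo.add_eq_zero]
  have ha := key (Pi.single a 1)
  rw [h0, one_mul, signChar_eq_one_iff, dotProduct_single_one] at ha
  exact ha

/-- Every Pauli operator with `z` part `Γ x` stabilizes the graph state with a suitable sign. -/
lemma IsGraphState.exists_isSignedPauli (hψ : IsGraphState G ψ) {f : Fin n → Fin 4}
    (hf : zBit ∘ f = adjMat2 G *ᵥ (xBit ∘ f)) :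
    ∃ g : QOp n, IsSignedPauli g f ∧ g *ᵥ ψ = ψ := by
  obtain ⟨s, hs⟩ := hψ.exists_apply_add (xBit ∘ f)
  obtain ⟨c, hc⟩ : ∃ c : ℂ, pauliOp f *ᵥ ψ = c • ψ := by
    refine ⟨(∏ i, pauliPhase (f i)) * s, amp_ext fun v => ?_⟩
    rw [amp_pauliOp_mulVec, hs, hf, amp_smul]
    linear_combination (∏ i, pauliPhase (f i)) * s * amp ψ v *
      signChar_mul_self ((adjMat2 G *ᵥ (xBit ∘ f)) ⬝ᵥ v)
  have hsq := pauliOp_mulVec_mulVec f ψ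
  rw [hc, Matrix.mulVec_smul, hc, smul_smul] at hsq
  have hcc : c * c = 1 := smul_left_injective ℂ hψ.ne_zero_s3 (by simpa using hsq)
  rcases mul_self_eq_one_iff.mp hcc with rfl | rfl
  · exact ⟨_, Or.inl rfl, by simpa using hc⟩
  · exact ⟨_, Or.inr rfl, by rw [Matrix.neg_mulVec, hc]; simp⟩

lemma IsGraphState.eq_of_isSignedPauli (hψ : IsGraphState G ψ) {g g' : QOp n}
    {f : Fin n → Fin 4} (hg : IsSignedPauli g f) (hg' : IsSignedPauli g' f)
    (h : g *ᵥ ψ = ψ) (h' : g' *ᵥ ψ = ψ) : g = g' := by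
  have aux : ∀ p : QOp n, p *ᵥ ψ = ψ → -p *ᵥ ψ ≠ ψ := by
    intro p hp hn
    rw [Matrix.neg_mulVec, hp] at hn
    exact hψ.ne_zero_s3 (neg_eq_self.mp hn)
  rcases hg with rfl | rfl <;> rcases hg' with rfl | rfl
  · rfl
  · exact absurd h' (aux _ h)
  · exact absurd h (aux _ h')
  · rfl

/-- Extension of a bit string on `A` by zero. -/
def extendByZero (A : Finset (Fin n)) (y : {a : Fin n // a ∈ A} → ZMod 2) : Fin n → ZMod 2 :=
  fun i => if h : i ∈ A then y ⟨i, h⟩ else 0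

lemma adjMat2_mulVec_extendByZero (A : Finset (Fin n)) (y : {a : Fin n // a ∈ A} → ZMod 2)
    (b : {b : Fin n // b ∉ A}) :
    (adjMat2 G *ᵥ extendByZero A y) b = ((adjCut G A)ᵀ *ᵥ y) b := by
  simp only [Matrix.mulVec, dotProduct]
  rw [← Finset.sum_subset (Finset.subset_univ A) (fun i _ hi => by simp [extendByZero, hi]),
    ← Finset.sum_coe_sort A]
  refine Finset.sum_congr rfl fun i _ => ?_
  rw [← transpose_adjMat2]
  simp [extendByZero, adjCut]

end GraphState

lemma natCard_ker_transpose_mulVecLin {ι κ : Type*} [Fintype ι] [Fintype κ]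
    (M : Matrix ι κ (ZMod 2)) :
    Nat.card (LinearMap.ker Mᵀ.mulVecLin) = 2 ^ (Fintype.card ι - M.rank) := by
  rw [Module.natCard_eq_pow_finrank (K := ZMod 2), Nat.card_zmod]
  have h := LinearMap.finrank_range_add_finrank_ker Mᵀ.mulVecLin
  rw [Module.finrank_fintype_fun_eq_card] at h
  have hr : Module.finrank (ZMod 2) (LinearMap.range Mᵀ.mulVecLin) = M.rank :=
    M.rank_transpose
  congr 1
  omega

/-- for a graph `G` on `n` vertices with graph state `|G⟩` and stabilizer `S`,
and `A ⊆ V`, the number of stabilizer elements `g = ±σ_{i_1} ⊗ ⋯ ⊗ σ_{i_n}` acting trivially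
outside `A` is exactly `2^{|A| - rank₂ Γ⟨A⟩}`. -/
theorem card_stabilizer_elements_supported_on
    {n : ℕ} (G : SimpleGraph (Fin n)) [DecidableRel G.Adj]
    (ψ : QState n) (hψ : IsGraphState G ψ) (A : Finset (Fin n)) :
    Set.ncard {g : QOp n | g ∈ stab ψ ∧
        ∃ f, IsSignedPauli g f ∧ ∀ α : Fin n, α ∉ A → f α = 0}
      = 2 ^ (A.card - (adjCut G A).rank) := by
  have hex : ∀ x : Fin n → ZMod 2, ∃ g : QOp n,
      IsSignedPauli g (fun i => pauliOfBits (x i) ((adjMat2 G *ᵥ x) i)) ∧ g *ᵥ ψ = ψ := by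
    intro x
    apply hψ.exists_isSignedPauli
    have hx : (xBit ∘ fun i => pauliOfBits (x i) ((adjMat2 G *ᵥ x) i)) = x :=
      funext fun i => xBit_pauliOfBits _ _
    rw [hx]
    exact funext fun i => zBit_pauliOfBits _ _
  choose F hF hFψ using hex
  have hinj : Function.Injective (F ∘ extendByZero A) := by
    intro y y' h
    have hg := hF (extendByZero A y')
    rw [← show F (extendByZero A y) = F (extendByZero A y') from h] at hg
    have hx := xBit_comp_eq_of_isSignedPauli (hF (extendByZero A y)) hg
    funext a
    have ha := congrFun hx a
    simpa [xBit_pauliOfBits, extendByZero] using ha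
  have himage : {g : QOp n | g ∈ stab ψ ∧
      ∃ f, IsSignedPauli g f ∧ ∀ α : Fin n, α ∉ A → f α = 0} =
      (F ∘ extendByZero A) '' (LinearMap.ker (adjCut G A)ᵀ.mulVecLin : Set _) := by
    ext g
    constructor
    · rintro ⟨⟨-, hgψ⟩, f, hgf, hfA⟩
      have hz := hψ.zBit_eq hgf hgψ
      have hx : extendByZero A (fun a => xBit (f a)) = xBit ∘ f := by
        funext i
        by_cases hi : i ∈ A
        · simp [extendByZero, hi]
        · simp [extendByZero, hi, hfA i hi, xBit]
      refine ⟨fun a => xBit (f a), ?_, ?_⟩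
      · refine LinearMap.mem_ker.mpr (funext fun b => ?_)
        rw [Matrix.mulVecLin_apply, ← adjMat2_mulVec_extendByZero, hx, ← hz]
        simp [hfA b b.2, zBit]
      · rw [Function.comp_apply, hx]
        refine hψ.eq_of_isSignedPauli (hF _) ?_ (hFψ _) hgψ
        rw [← hz]
        simpa [pauliOfBits_xBit_zBit] using hgf
    · rintro ⟨y, hy, rfl⟩
      refine ⟨⟨⟨_, hF _⟩, hFψ _⟩, _, hF _, fun b hb => ?_⟩
      have hyb : (adjMat2 G *ᵥ extendByZero A y) b = 0 :=
        (adjMat2_mulVec_extendByZero A y ⟨b, hb⟩).trans (congrFun (LinearMap.mem_ker.mp hy) _)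
      simp only [hyb]
      simp [extendByZero, hb, pauliOfBits]
  rw [himage, Set.ncard_image_of_injective _ hinj, ← Nat.card_coe_set_eq]
  exact (natCard_ker_transpose_mulVecLin (adjCut G A)).trans (by rw [Fintype.card_coe])
end
end
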